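/- arXiv:1112.2864 — 4 statements merged into one kernel-verified Lean document; each statement's English description precedes it below -/
import Mathlib

section
/- Let G = (V, Σ, P) be a context-free grammar and let r_max ≥ 1 be the maximal number of variable occurrences on the right-hand side of a production of G. Then for every X ∈ V and every (G,X)-derivation tree t, dim(t) < minidx(t) ≤ dim(t)·(r_max − 1) + 1. -/
/-- A context-free grammar over variables `V` and terminal alphabet `A`:
a set of productions `X → rhs` with `rhs ∈ (A ⊕ V)*`. -/
structure CFG (V : Type) (A : Type) where
  P : Set (V × List (A ⊕ V))

/-- The list of variable occurrences (in order) in a sentential form. -/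
def varsOf {V A : Type} (rhs : List (A ⊕ V)) : List V :=
  rhs.filterMap Sum.getRight?

/-- Raw derivation trees: each node is labeled by a variable and a right-hand side,
and carries the list of subtrees (one per variable occurrence of the rhs). -/
inductive RawTree (V A : Type) : Type where
  | node (X : V) (rhs : List (A ⊕ V)) (children : List (RawTree V A)) : RawTree V A

namespace RawTree

/-- `IsDTree G X t` : `t` is a `(G,X)`-derivation tree. -/
inductive IsDTree {V A : Type} (G : CFG V A) : V → RawTree V A → Prop where
  | node {X : V} {rhs : List (A ⊕ V)} {children : List (RawTree V A)}
      (hP : (X, rhs) ∈ G.P)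
      (hch : List.Forall₂ (IsDTree G) (varsOf rhs) children) :
      IsDTree G X (RawTree.node X rhs children)

/-- Helper for `yield`: interleave the terminals of a rhs with the yields of the
subtrees (consumed in order, one per variable occurrence). -/
def yieldAux {V A : Type} : List (A ⊕ V) → List (List A) → List A
  | [], _ => []
  | (Sum.inl a) :: rest, ys => a :: yieldAux rest ys
  | (Sum.inr _) :: rest, [] => yieldAux rest []
  | (Sum.inr _) :: rest, y :: ys => y ++ yieldAux rest ys

/-- The yield of a derivation tree. -/
def yield {V A : Type} : RawTree V A → List A
  | .node _ rhs cs => yieldAux rhs (cs.attach.map (fun c => yield c.1))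
decreasing_by have := List.sizeOf_lt_of_mem c.2; simp; omega

/-- The dimension (Horton–Strahler number) of a tree. -/
def dim {V A : Type} : RawTree V A → ℕ
  | .node _ _ cs =>
    let ds := cs.attach.map (fun c => dim c.1)
    if ds.isEmpty then 0
    else
      let d := ds.foldr max 0
      if ds.count d = 1 then d else d + 1
decreasing_by have := List.sizeOf_lt_of_mem c.2; simp; omega

/-- The set of variables occurring as left-hand side of a label of some node of `t`. -/
def lhsVars {V A : Type} [DecidableEq V] : RawTree V A → Finset V
  | .node X _ cs => insert X ((cs.attach.map (fun c => lhsVars c.1)).foldr (· ∪ ·) ∅)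
decreasing_by have := List.sizeOf_lt_of_mem c.2; simp; omega

/-- `l(t)`: the number of distinct variables labelling (as lhs) the nodes of `t`. -/
def numLhsVars {V A : Type} [DecidableEq V] (t : RawTree V A) : ℕ := (lhsVars t).card

end RawTree

open RawTree

/-- The Parikh image of a word. -/
noncomputable def parikh {A : Type} (w : List A) : A →₀ ℕ :=
  (w.map (fun a => Finsupp.single a 1)).sum

/-- The ambiguity of `(G,X)` at a word `w`: the number of `(G,X)`-derivation trees
with yield `w`, as an extended natural number. -/
noncomputable def amb {V A : Type} (G : CFG V A) (X : V) (w : List A) : ℕ∞ :=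
  Set.encard {t : RawTree V A | IsDTree G X t ∧ yield t = w}

/-- The commutative ambiguity of `(G,X)` at a Parikh vector `v`: the number of
`(G,X)`-derivation trees whose yield has Parikh image `v`. -/
noncomputable def camb {V A : Type} (G : CFG V A) (X : V) (v : A →₀ ℕ) : ℕ∞ :=
  Set.encard {t : RawTree V A | IsDTree G X t ∧ parikh (yield t) = v}

/-- One rewriting step of `G` on sentential forms. -/
def Produces {V A : Type} (G : CFG V A) (α β : List (A ⊕ V)) : Prop :=
  ∃ pre post X rhs, (X, rhs) ∈ G.P ∧
    α = pre ++ Sum.inr X :: post ∧ β = pre ++ rhs ++ post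

/-- Derivation in one or more steps (`⇒⁺`). -/
def DerivesPlus {V A : Type} (G : CFG V A) : List (A ⊕ V) → List (A ⊕ V) → Prop :=
  Relation.TransGen (Produces G)

/-- Derivation in zero or more steps (`⇒*`). -/
def Derives {V A : Type} (G : CFG V A) : List (A ⊕ V) → List (A ⊕ V) → Prop :=
  Relation.ReflTransGen (Produces G)

/-- A grammar is nonexpansive if no variable `X` derives a sentential form
containing two or more occurrences of `X`. -/
def Nonexpansive {V A : Type} [DecidableEq V] [DecidableEq A] (G : CFG V A) : Prop :=
  ∀ (X : V) (α : List (A ⊕ V)), DerivesPlus G [Sum.inr X] α → α.count (Sum.inr X) ≤ 1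

/-! ### Derivations corresponding to a fixed derivation tree, and `minidx` -/

/-- Replace, in order, each variable occurrence of `rhs` by the corresponding
pending subtree. Items are either terminals or pending derivation trees. -/
def expandItems {V A : Type} : List (A ⊕ V) → List (RawTree V A) → List (A ⊕ RawTree V A)
  | [], _ => []
  | (Sum.inl a) :: rest, cs => Sum.inl a :: expandItems rest cs
  | (Sum.inr _) :: rest, [] => expandItems rest []
  | (Sum.inr _) :: rest, c :: cs => Sum.inr c :: expandItems rest cs

/-- One step of a derivation corresponding to a tree: some pending tree is replaced
by its rhs, with the variable occurrences replaced by its subtrees. -/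
inductive DStep {V A : Type} : List (A ⊕ RawTree V A) → List (A ⊕ RawTree V A) → Prop where
  | mk (pre post : List (A ⊕ RawTree V A)) (X : V) (rhs : List (A ⊕ V))
      (cs : List (RawTree V A)) :
      DStep (pre ++ Sum.inr (RawTree.node X rhs cs) :: post)
            (pre ++ expandItems rhs cs ++ post)

/-- The number of variable occurrences of the sentential form represented by a state. -/
def stateIndex {V A : Type} (s : List (A ⊕ RawTree V A)) : ℕ :=
  (s.filter (fun i => i.isRight)).length

/-- `IsDerivationOf t ss` : `ss` is the sequence of states of a (complete) derivation
corresponding to the derivation tree `t`. -/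
def IsDerivationOf {V A : Type} (t : RawTree V A) (ss : List (List (A ⊕ RawTree V A))) : Prop :=
  ss.head? = some [Sum.inr t] ∧ List.Chain' DStep ss ∧
  ∃ last, ss.getLast? = some last ∧ ∀ i ∈ last, i.isLeft

/-- The index of a derivation: the maximal number of variable occurrences in any
of its sentential forms. -/
def derivIndex {V A : Type} (ss : List (List (A ⊕ RawTree V A))) : ℕ :=
  (ss.map stateIndex).foldr max 0

/-- `minidx t`: the minimal index of a derivation corresponding to `t`. -/
noncomputable def minidx {V A : Type} (t : RawTree V A) : ℕ :=
  sInf { m | ∃ ss, IsDerivationOf t ss ∧ derivIndex ss = m }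

/-! ### Pending trees of a state -/

/-- The pending trees of a state, from left to right. -/
def pending {V A : Type} (s : List (A ⊕ RawTree V A)) : List (RawTree V A) :=
  s.filterMap Sum.getRight?

/-- The trees that become pending when the root of a tree is rewritten. -/
def successors {V A : Type} : RawTree V A → List (RawTree V A)
  | .node _ rhs cs => pending (expandItems rhs cs)

theorem length_pending {V A : Type} (s : List (A ⊕ RawTree V A)) :
    (pending s).length = stateIndex s := by
  induction s with
  | nil => rfl
  | cons a s ih => cases a <;> simp_all [pending, stateIndex, List.filterMap_cons, List.filter_cons]

theorem pending_eq_nil_iff {V A : Type} {s : List (A ⊕ RawTree V A)} :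
    pending s = [] ↔ ∀ i ∈ s, i.isLeft := by
  induction s with
  | nil => simp [pending]
  | cons a s ih => cases a <;> simp_all [pending]

theorem pending_append {V A : Type} (s s' : List (A ⊕ RawTree V A)) :
    pending (s ++ s') = pending s ++ pending s' :=
  List.filterMap_append

theorem pending_expandItems {V A : Type} {rhs : List (A ⊕ V)} {cs : List (RawTree V A)}
    (h : (varsOf rhs).length = cs.length) : pending (expandItems rhs cs) = cs := by
  induction rhs generalizing cs with
  | nil => simpa [varsOf, expandItems, pending, eq_comm] using h
  | cons a rhs ih =>
    cases a with
    | inl a =>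
      simpa [expandItems, pending, List.filterMap_cons] using
        ih (by simpa [varsOf, List.filterMap_cons] using h)
    | inr v =>
      cases cs with
      | nil => simp [varsOf] at h
      | cons c cs =>
        simpa [expandItems, pending, List.filterMap_cons] using
          ih (by simpa [varsOf, List.filterMap_cons] using h)

/-- An element split off from a sum of two multisets belongs to one of the summands. -/
theorem Multiset.exists_of_cons_eq_add {α : Type} {t : α} {L M N : Multiset α}
    (h : t ::ₘ L = M + N) :
    (∃ M', M = t ::ₘ M' ∧ L = M' + N) ∨ ∃ N', N = t ::ₘ N' ∧ L = M + N' := by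
  have ht : t ∈ M + N := h ▸ Multiset.mem_cons_self t L
  rcases Multiset.mem_add.1 ht with ht | ht
  · obtain ⟨M', rfl⟩ := Multiset.exists_cons_of_mem ht
    exact Or.inl ⟨M', rfl, by simpa using h⟩
  · obtain ⟨N', rfl⟩ := Multiset.exists_cons_of_mem ht
    exact Or.inr ⟨N', rfl, by simpa using h⟩

/-! ### Finishing a multiset of pending trees within a given index -/

/-- `Finishes k M`: the multiset `M` of pending trees can be completely rewritten in such a way
that at most `k` trees are pending at any time. -/
inductive Finishes {V A : Type} (k : ℕ) : Multiset (RawTree V A) → Prop where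
  | zero : Finishes k 0
  | step (t : RawTree V A) (M : Multiset (RawTree V A)) (hcard : M.card + 1 ≤ k)
      (h : Finishes k ((successors t : Multiset (RawTree V A)) + M)) : Finishes k (t ::ₘ M)

namespace Finishes

variable {V A : Type} {k m : ℕ} {M N : Multiset (RawTree V A)}

theorem card_le (h : Finishes k M) : M.card ≤ k := by
  cases h with
  | zero => simp
  | step t M hcard h => simpa using hcard

theorem add (hM : Finishes k M) (hN : Finishes m N) (hk : N.card + k ≤ m) :
    Finishes m (M + N) := by
  induction hM with
  | zero => simpa using hN
  | step t M hcard h ih =>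
    rw [Multiset.cons_add]
    refine step t _ (by rw [Multiset.card_add]; omega) ?_
    rwa [← add_assoc]

theorem add_of_forall (hM : ∀ t ∈ M, Finishes k {t}) (hN : Finishes m N)
    (hk : M ≠ 0 → M.card + N.card + k ≤ m + 1) : Finishes m (M + N) := by
  induction M using Multiset.induction_on with
  | empty => simpa using hN
  | cons t M ih =>
    have hk' := hk (by simp)
    rw [Multiset.card_cons] at hk'
    rw [← Multiset.singleton_add, add_assoc]
    refine (hM t (by simp)).add (ih (fun u hu => hM u (by simp [hu])) fun _ => by omega) ?_
    rw [Multiset.card_add]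
    omega

theorem of_add_left (h : Finishes k (M + N)) : Finishes k M := by
  generalize hL : M + N = L at h
  induction h generalizing M N with
  | zero => rw [(add_eq_zero.1 hL).1]; exact zero
  | step t L hcard h ih =>
    rcases Multiset.exists_of_cons_eq_add hL.symm with ⟨M', rfl, rfl⟩ | ⟨N', rfl, rfl⟩
    · rw [Multiset.card_add] at hcard
      exact step t M' (by omega) (ih (N := N) (add_assoc _ _ _))
    · exact ih (N := (successors t : Multiset (RawTree V A)) + N') (add_left_comm _ _ _)

/-- If two families of trees are rewritten in parallel, then one of them is rewritten within a
strictly smaller index. -/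
theorem or_of_add (h : Finishes (k + 1) (M + N)) : Finishes k M ∨ Finishes k N := by
  generalize hL : M + N = L at h
  induction h generalizing M N with
  | zero => rw [(add_eq_zero.1 hL).1]; exact Or.inl zero
  | step t L hcard h ih =>
    rcases Multiset.exists_of_cons_eq_add hL.symm with ⟨M', rfl, rfl⟩ | ⟨N', rfl, rfl⟩
    · rw [Multiset.card_add] at hcard
      rcases Nat.eq_zero_or_pos N.card with hN | hN
      · rw [Multiset.card_eq_zero.1 hN]; exact Or.inr zero
      · exact (ih (add_assoc _ _ _)).imp_left (step t M' (by omega))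
    · rw [Multiset.card_add] at hcard
      rcases Nat.eq_zero_or_pos M.card with hM | hM
      · rw [Multiset.card_eq_zero.1 hM]; exact Or.inl zero
      · exact (ih (add_left_comm _ _ _)).imp_right (step t N' (by omega))

end Finishes

/-! ### Derivations and `Finishes` -/

theorem derivIndex_cons {V A : Type} (s : List (A ⊕ RawTree V A))
    (ss : List (List (A ⊕ RawTree V A))) :
    derivIndex (s :: ss) = max (stateIndex s) (derivIndex ss) := rfl

theorem DStep.exists_pending {V A : Type} {s s' : List (A ⊕ RawTree V A)} (h : DStep s s') :
    ∃ t M, (pending s : Multiset (RawTree V A)) = t ::ₘ M ∧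
      (pending s' : Multiset (RawTree V A)) = (successors t : Multiset (RawTree V A)) + M := by
  obtain ⟨pre, post, X, rhs, cs⟩ := h
  refine ⟨.node X rhs cs, pending pre + pending post, ?_, ?_⟩
  · have h' : pending (pre ++ Sum.inr (RawTree.node X rhs cs) :: post) =
        pending pre ++ .node X rhs cs :: pending post := by simp [pending]
    rw [h', ← Multiset.coe_add, ← Multiset.cons_coe, Multiset.add_cons]
  · rw [pending_append, pending_append, ← Multiset.coe_add, ← Multiset.coe_add, successors,
      add_assoc, add_left_comm]

theorem exists_dStep_of_mem {V A : Type} {s : List (A ⊕ RawTree V A)} {t : RawTree V A}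
    {M : Multiset (RawTree V A)} (h : (pending s : Multiset (RawTree V A)) = t ::ₘ M) :
    ∃ s', DStep s s' ∧
      (pending s' : Multiset (RawTree V A)) = (successors t : Multiset (RawTree V A)) + M := by
  have ht : t ∈ pending s := by
    rw [← Multiset.mem_coe, h]; exact Multiset.mem_cons_self t M
  have ht' : Sum.inr t ∈ s := by simpa [pending] using ht
  obtain ⟨pre, post, rfl⟩ := List.append_of_mem ht'
  obtain ⟨X, rhs, cs⟩ := t
  refine ⟨_, .mk pre post X rhs cs, ?_⟩
  have h' : pending (pre ++ Sum.inr (RawTree.node X rhs cs) :: post) =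
      pending pre ++ .node X rhs cs :: pending post := by simp [pending]
  rw [h', ← Multiset.coe_add, ← Multiset.cons_coe, Multiset.add_cons, Multiset.cons_inj_right] at h
  rw [pending_append, pending_append, ← Multiset.coe_add, ← Multiset.coe_add, successors,
    ← h, add_assoc, add_left_comm]

theorem finishes_of_isChain {V A : Type} {k : ℕ} {ss : List (List (A ⊕ RawTree V A))}
    {s last : List (A ⊕ RawTree V A)} (hchain : List.IsChain DStep (s :: ss))
    (hlast : (s :: ss).getLast? = some last) (hleft : ∀ i ∈ last, i.isLeft)
    (hk : derivIndex (s :: ss) ≤ k) : Finishes k (pending s : Multiset (RawTree V A)) := by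
  induction ss generalizing s with
  | nil =>
    obtain rfl : s = last := by simpa using hlast
    rw [pending_eq_nil_iff.2 hleft]
    exact .zero
  | cons s' ss ih =>
    rw [List.isChain_cons_cons] at hchain
    rw [derivIndex_cons, max_le_iff] at hk
    have h := ih hchain.2 (by simpa using hlast) hk.2
    obtain ⟨t, M, hs, hs'⟩ := hchain.1.exists_pending
    have hcard := congrArg Multiset.card hs
    rw [Multiset.coe_card, length_pending, Multiset.card_cons] at hcard
    rw [hs'] at h
    rw [hs]
    exact .step t M (hcard ▸ hk.1) h

theorem Finishes.exists_isChain {V A : Type} {k : ℕ} {M : Multiset (RawTree V A)}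
    (h : Finishes k M) {s : List (A ⊕ RawTree V A)}
    (hs : (pending s : Multiset (RawTree V A)) = M) :
    ∃ ss last, List.IsChain DStep (s :: ss) ∧ (s :: ss).getLast? = some last ∧
      (∀ i ∈ last, i.isLeft) ∧ derivIndex (s :: ss) ≤ k := by
  have hidx : stateIndex s ≤ k := by
    rw [← length_pending, ← Multiset.coe_card, hs]; exact h.card_le
  induction h generalizing s with
  | zero =>
    refine ⟨[], s, List.isChain_singleton s, rfl, ?_, by simpa [derivIndex] using hidx⟩
    exact pending_eq_nil_iff.1 (by simpa using hs)
  | step t M hcard h ih =>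
    obtain ⟨s', hstep, hs'⟩ := exists_dStep_of_mem hs
    obtain ⟨ss, last, hchain, hlast, hleft, hk⟩ := ih hs' (by
      rw [← length_pending, ← Multiset.coe_card, hs']; exact h.card_le)
    exact ⟨s' :: ss, last, List.isChain_cons_cons.2 ⟨hstep, hchain⟩, by simpa using hlast, hleft,
      by rw [derivIndex_cons]; exact max_le hidx hk⟩

theorem exists_isDerivationOf_iff_finishes {V A : Type} {k : ℕ} {t : RawTree V A} :
    (∃ ss, IsDerivationOf t ss ∧ derivIndex ss ≤ k) ↔ Finishes k {t} := by
  constructor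
  · rintro ⟨ss, ⟨hhead, hchain, last, hlast, hleft⟩, hk⟩
    cases ss with
    | nil => simp at hhead
    | cons s ss =>
      obtain rfl : s = [Sum.inr t] := by simpa using hhead
      exact finishes_of_isChain hchain hlast hleft hk
  · intro h
    obtain ⟨ss, last, hchain, hlast, hleft, hk⟩ :=
      h.exists_isChain (s := [Sum.inr t]) (by simp [pending])
    exact ⟨_, ⟨rfl, hchain, last, hlast, hleft⟩, hk⟩

/-! ### Dimension -/

/-- The children of a node, split into one of maximal dimension and the others. -/
theorem exists_cons_dim {V A : Type} (X : V) (rhs : List (A ⊕ V)) {cs : List (RawTree V A)}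
    (hcs : cs ≠ []) :
    ∃ c M, (cs : Multiset (RawTree V A)) = c ::ₘ M ∧
      dim c ≤ dim (.node X rhs cs) ∧ (∀ u ∈ M, dim u + 1 ≤ dim (.node X rhs cs)) ∧
      (dim (.node X rhs cs) = dim c ∨
        dim (.node X rhs cs) = dim c + 1 ∧ ∃ u ∈ M, dim u = dim c) := by
  classical
  obtain ⟨c, hc, hmax⟩ := cs.toFinset.exists_max_image dim (List.toFinset_nonempty_iff cs |>.2 hcs)
  simp only [List.mem_toFinset] at hc hmax
  have hfold : (cs.map dim).foldr max 0 = dim c := by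
    refine le_antisymm (List.max_le_of_forall_le _ _ (by simpa using hmax)) ?_
    exact List.le_max_of_le (List.mem_map_of_mem hc) le_rfl
  have hd : dim (.node X rhs cs) = if (cs.map dim).count (dim c) = 1 then dim c else dim c + 1 := by
    have h : ((cs.map dim).isEmpty) = false := by simpa using hcs
    rw [dim, List.attach_map_val]
    simp [h, hfold]
  obtain ⟨M, hM⟩ := Multiset.exists_cons_of_mem (Multiset.mem_coe.2 hc)
  have hcount : (cs.map dim).count (dim c) = (M.map dim).count (dim c) + 1 := by
    rw [← Multiset.coe_count, ← Multiset.map_coe, hM, Multiset.map_cons, Multiset.count_cons_self]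
  have hmaxM : ∀ u ∈ M, dim u ≤ dim c := fun u hu =>
    hmax u (by rw [← Multiset.mem_coe, hM]; exact Multiset.mem_cons_of_mem hu)
  refine ⟨c, M, hM, ?_⟩
  by_cases h : dim c ∈ M.map dim
  · have hpos := Multiset.count_pos.2 h
    rw [if_neg (by omega)] at hd
    rw [hd]
    exact ⟨by omega, fun u hu => Nat.succ_le_succ (hmaxM u hu), Or.inr ⟨rfl, Multiset.mem_map.1 h⟩⟩
  · rw [hcount, Multiset.count_eq_zero.2 h, if_pos rfl] at hd
    rw [hd]
    refine ⟨le_rfl, fun u hu => (hmaxM u hu).lt_of_ne fun hne => h ?_, Or.inl rfl⟩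
    exact Multiset.mem_map.2 ⟨u, hu, hne⟩

theorem List.Forall₂.exists_of_mem_right {α β : Type} {R : α → β → Prop} {l : List α} {l' : List β}
    (h : List.Forall₂ R l l') {b : β} (hb : b ∈ l') : ∃ a, R a b := by
  induction h with
  | nil => simp at hb
  | cons hab _ ih =>
    rcases List.mem_cons.1 hb with rfl | hb
    · exact ⟨_, hab⟩
    · exact ih hb

theorem RawTree.IsDTree.lt_of_finishes {V A : Type} {G : CFG V A} :
    ∀ {X : V} {t : RawTree V A}, IsDTree G X t → ∀ {k : ℕ}, Finishes k {t} → dim t < k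
  | X, .node _ rhs cs, .node hP hch, k, h => by
    generalize hL : ({RawTree.node X rhs cs} : Multiset (RawTree V A)) = L at h
    cases h with
    | zero => simp at hL
    | step t M hcard h =>
      obtain ⟨rfl, rfl⟩ := (Multiset.singleton_eq_cons_iff _).1 hL
      rw [successors, pending_expandItems hch.length_eq, add_zero] at h
      have ih : ∀ c ∈ cs, ∀ {k : ℕ}, Finishes k {c} → dim c < k := by
        intro c hc k hk
        obtain ⟨Y, hY⟩ := hch.exists_of_mem_right hc
        exact IsDTree.lt_of_finishes hY hk
      by_cases hcs : cs = []
      · subst hcs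
        rw [dim]
        simpa [Nat.lt_iff_add_one_le] using hcard
      obtain ⟨c, N, hN, -, -, hdim⟩ := exists_cons_dim X rhs hcs
      have hmem : ∀ u, u = c ∨ u ∈ N → u ∈ cs := fun u hu => by
        rw [← Multiset.mem_coe, hN]; exact Multiset.mem_cons.2 hu
      rw [hN] at h
      rcases hdim with hdim | ⟨hdim, u, hu, huc⟩
      · rw [hdim]
        exact ih c (hmem c (Or.inl rfl)) (Finishes.of_add_left (N := N) h)
      · obtain ⟨k, rfl⟩ : ∃ j, k = j + 1 := ⟨k - 1, by omega⟩
        obtain ⟨N', rfl⟩ := Multiset.exists_cons_of_mem hu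
        rw [hdim]
        rcases Finishes.or_of_add (M := {c}) (N := u ::ₘ N') h with h | h
        · have := ih c (hmem c (Or.inl rfl)) h
          omega
        · have := ih u (hmem u (Or.inr hu)) (Finishes.of_add_left (N := N') h)
          omega
termination_by _ t => sizeOf t
decreasing_by have := List.sizeOf_lt_of_mem hc; simp; omega

theorem RawTree.IsDTree.finishes {V A : Type} {G : CFG V A} {r : ℕ}
    (hr : ∀ p ∈ G.P, (varsOf p.2).length ≤ r) :
    ∀ {X : V} {t : RawTree V A}, IsDTree G X t → ∀ {k : ℕ}, dim t * (r - 1) + 1 ≤ k →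
      Finishes k {t}
  | X, .node _ rhs cs, .node hP hch, k, hk => by
    refine .step _ 0 (by simp; omega) ?_
    rw [successors, pending_expandItems hch.length_eq, add_zero]
    have ih : ∀ c ∈ cs, ∀ {k : ℕ}, dim c * (r - 1) + 1 ≤ k → Finishes k {c} := by
      intro c hc k hk
      obtain ⟨Y, hY⟩ := hch.exists_of_mem_right hc
      exact IsDTree.finishes hr hY hk
    by_cases hcs : cs = []
    · subst hcs
      exact .zero
    obtain ⟨c, N, hN, hc, hu, -⟩ := exists_cons_dim X rhs hcs
    have hmem : ∀ u, u = c ∨ u ∈ N → u ∈ cs := fun u hu => by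
      rw [← Multiset.mem_coe, hN]; exact Multiset.mem_cons.2 hu
    have hlen : N.card + 1 ≤ r := by
      have h := congrArg Multiset.card hN
      rw [Multiset.coe_card, Multiset.card_cons, ← hch.length_eq] at h
      exact h ▸ hr _ hP
    set d := dim (.node X rhs cs)
    rw [hN, ← Multiset.singleton_add, add_comm]
    refine Finishes.add_of_forall (k := (d - 1) * (r - 1) + 1) (fun u h => ?_)
      (ih c (hmem c (Or.inl rfl)) ?_) fun h => ?_
    · refine ih u (hmem u (Or.inr h)) ?_
      have := Nat.mul_le_mul_right (r - 1) (Nat.le_sub_of_add_le (hu u h))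
      omega
    · have := Nat.mul_le_mul_right (r - 1) hc
      omega
    · obtain ⟨u, h⟩ := Multiset.exists_mem_of_ne_zero h
      have hd := hu u h
      obtain ⟨e, he⟩ : ∃ e, d = e + 1 := ⟨d - 1, by omega⟩
      rw [he, Nat.add_mul] at hk
      rw [he, Multiset.card_singleton, Nat.add_sub_cancel]
      omega
termination_by _ t => sizeOf t
decreasing_by have := List.sizeOf_lt_of_mem hc; simp; omega

theorem dim_lt_minidx_le {V A : Type} [Fintype V] [Fintype A]
    (G : CFG V A) (hGfin : G.P.Finite) (rmax : ℕ) (hr1 : 1 ≤ rmax)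
    (hrmax : ∀ p ∈ G.P, (varsOf p.2).length ≤ rmax)
    (X : V) (t : RawTree V A) (ht : IsDTree G X t) :
    dim t < minidx t ∧ minidx t ≤ dim t * (rmax - 1) + 1 := by
  obtain ⟨ss, hss, hk⟩ :=
    exists_isDerivationOf_iff_finishes.2 (ht.finishes hrmax le_rfl)
  have hmem : derivIndex ss ∈ { m | ∃ ss, IsDerivationOf t ss ∧ derivIndex ss = m } :=
    ⟨ss, hss, rfl⟩
  refine ⟨?_, (Nat.sInf_le hmem).trans hk⟩
  obtain ⟨ss', hss', hmin⟩ := Nat.sInf_mem ⟨_, hmem⟩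
  exact ht.lt_of_finishes (exists_isDerivationOf_iff_finishes.1 ⟨ss', hss', hmin.le⟩)
end

section
/- Let G = (V, Σ, P) be a context-free grammar, k ∈ ℕ, and let G^{≤k} be its unfolding. Then every (G^{≤k}, X^{=d})-derivation tree has dimension exactly d, and every (G^{≤k}, X^{≤d})-derivation tree has dimension at most d. -/
open RawTree

/-! ### The unfolded grammar `G^{≤k}` -/

/-- Variables of the unfolded grammar: `UVar.le X d` stands for `X^{≤d}` and
`UVar.eq X d` stands for `X^{=d}`. -/
inductive UVar (V : Type) : Type where
  | le (X : V) (d : ℕ) : UVar V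
  | eq (X : V) (d : ℕ) : UVar V
  deriving DecidableEq

/-- Replace, in order, each variable occurrence of `rhs` by the corresponding
annotated variable from `zs` (terminals are kept). -/
def relabel {V A : Type} : List (A ⊕ V) → List (UVar V) → List (A ⊕ UVar V)
  | [], _ => []
  | (Sum.inl a) :: rest, zs => Sum.inl a :: relabel rest zs
  | (Sum.inr _) :: rest, [] => relabel rest []
  | (Sum.inr _) :: rest, z :: zs => Sum.inr z :: relabel rest zs

/-- The productions of the unfolded grammar `G^{≤k}`. -/
def unfoldP {V A : Type} (G : CFG V A) (k : ℕ) : Set (UVar V × List (A ⊕ UVar V)) :=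
  -- (1)  X^{≤d} → X^{=e}  for e ≤ d ≤ k
  { p | ∃ X d e, e ≤ d ∧ d ≤ k ∧ p = (UVar.le X d, [Sum.inr (UVar.eq X e)]) } ∪
  -- (2)  X^{=0} → u₀  whenever X → u₀ with u₀ ∈ Σ*
  { p | ∃ X rhs, (X, rhs) ∈ G.P ∧ varsOf rhs = [] ∧
        p = (UVar.eq X 0, relabel rhs []) } ∪
  -- (3)  X^{=d} → u₀ X₁^{=d} u₁  whenever X → u₀X₁u₁ (one variable occurrence), d ≤ k
  { p | ∃ X rhs Y d, (X, rhs) ∈ G.P ∧ varsOf rhs = [Y] ∧ d ≤ k ∧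
        p = (UVar.eq X d, relabel rhs [UVar.eq Y d]) } ∪
  -- (4a)
  { p | ∃ X rhs d j, (X, rhs) ∈ G.P ∧ 2 ≤ (varsOf rhs).length ∧
        1 ≤ d ∧ d ≤ k ∧ j < (varsOf rhs).length ∧
        p = (UVar.eq X d, relabel rhs ((varsOf rhs).mapIdx (fun i Y =>
              if i = j then UVar.eq Y d else UVar.le Y (d - 1)))) } ∪
  -- (4b)
  { p | ∃ X rhs d, ∃ J : Finset ℕ, (X, rhs) ∈ G.P ∧ 2 ≤ (varsOf rhs).length ∧
        1 ≤ d ∧ d ≤ k ∧ 2 ≤ J.card ∧ (∀ i ∈ J, i < (varsOf rhs).length) ∧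
        (2 ≤ d ∨ J = Finset.range (varsOf rhs).length) ∧
        p = (UVar.eq X d, relabel rhs ((varsOf rhs).mapIdx (fun i Y =>
              if i ∈ J then UVar.eq Y (d - 1) else UVar.le Y (d - 2)))) }

/-- The unfolded grammar `G^{≤k}`. -/
def unfold {V A : Type} (G : CFG V A) (k : ℕ) : CFG (UVar V) A :=
  ⟨unfoldP G k⟩

theorem varsOf_relabel {V A : Type} (rhs : List (A ⊕ V)) (zs : List (UVar V))
    (h : zs.length = (varsOf rhs).length) : varsOf (relabel rhs zs) = zs := by
  induction rhs generalizing zs with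
  | nil => simpa [varsOf, relabel, eq_comm] using h
  | cons s rest ih =>
    cases s with
    | inl a => exact ih zs h
    | inr Y =>
      cases zs with
      | nil => simp [varsOf] at h
      | cons z zs =>
        have h' : zs.length = (varsOf rest).length := by simpa [varsOf] using h
        exact congrArg (z :: ·) (ih zs h')

theorem foldr_max_eq_of_mem {ds : List ℕ} {d : ℕ} (hmem : d ∈ ds) (hle : ∀ x ∈ ds, x ≤ d) :
    ds.foldr max 0 = d :=
  le_antisymm (List.max_le_of_forall_le _ _ hle) (List.le_max_of_le hmem le_rfl)

namespace RawTree

/-- The dimension of a tree as a function of the dimensions of its root subtrees. -/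
def dimOfList (ds : List ℕ) : ℕ :=
  if ds.isEmpty then 0
  else if ds.count (ds.foldr max 0) = 1 then ds.foldr max 0 else ds.foldr max 0 + 1

theorem dim_node {V A : Type} (X : V) (rhs : List (A ⊕ V)) (cs : List (RawTree V A)) :
    dim (node X rhs cs) = dimOfList (cs.map dim) := by
  rw [dim]
  simp [dimOfList]

theorem dimOfList_singleton (d : ℕ) : dimOfList [d] = d := by
  simp [dimOfList]

theorem dimOfList_of_unique_max {ds : List ℕ} {d j : ℕ} (hj : j < ds.length) (hd : ds[j] = d)
    (hlt : ∀ i (hi : i < ds.length), i ≠ j → ds[i] < d) : dimOfList ds = d := by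
  have hmem : d ∈ ds := hd ▸ List.getElem_mem hj
  have hmax : ds.foldr max 0 = d := foldr_max_eq_of_mem hmem fun x hx => by
    obtain ⟨i, hi, rfl⟩ := List.getElem_of_mem hx
    by_cases hij : i = j
    · subst hij; exact hd.le
    · exact (hlt i hi hij).le
  have hcount : ds.count d = 1 := by
    refine le_antisymm (not_lt.mp fun h => ?_) (List.count_pos_iff.mpr hmem)
    obtain ⟨n, m, hnm, hn, hm⟩ :=
      List.duplicate_iff_exists_distinct_get.mp (List.duplicate_iff_two_le_count.mpr h)
    have eq_j : ∀ i : Fin ds.length, d = ds.get i → i.1 = j := fun i hi => by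
      by_contra hne
      exact absurd hi (hlt i i.2 hne).ne'
    exact absurd ((eq_j n hn).trans (eq_j m hm).symm) (Fin.lt_def.mp hnm).ne
  simp [dimOfList, hmax, hcount, List.ne_nil_of_mem hmem]

theorem dimOfList_of_repeated_max {ds : List ℕ} {e a b : ℕ} (hab : a ≠ b)
    (ha : a < ds.length) (hb : b < ds.length) (hae : ds[a] = e) (hbe : ds[b] = e)
    (hle : ∀ x ∈ ds, x ≤ e) : dimOfList ds = e + 1 := by
  wlog hlt : a < b generalizing a b
  · exact this hab.symm hb ha hbe hae (by omega)
  have hmem : e ∈ ds := hae ▸ List.getElem_mem ha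
  have hcount : 2 ≤ ds.count e := List.duplicate_iff_two_le_count.mp
    (List.duplicate_iff_exists_distinct_get.mpr
      ⟨⟨a, ha⟩, ⟨b, hb⟩, hlt, hae.symm, hbe.symm⟩)
  have hne : ds.count e ≠ 1 := by omega
  simp [dimOfList, foldr_max_eq_of_mem hmem hle, hne, List.ne_nil_of_mem hmem]

end RawTree

/-- The constraint that an annotated variable imposes on the dimension of its trees. -/
def UVar.Admits {V : Type} : UVar V → ℕ → Prop
  | .le _ d, n => n ≤ d
  | .eq _ d, n => n = d

theorem admits_dimOfList_of_mem_unfoldP {V A : Type} {G : CFG V A} {k : ℕ} {Z : UVar V}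
    {rhs : List (A ⊕ UVar V)} {ds : List ℕ} (hP : (Z, rhs) ∈ unfoldP G k)
    (hds : List.Forall₂ UVar.Admits (varsOf rhs) ds) : Z.Admits (dimOfList ds) := by
  rcases hP with (((⟨X, d, e, hed, -, hp⟩ | ⟨X, rhs', -, hvars, hp⟩) |
      ⟨X, rhs', Y, d, -, hvars, -, hp⟩) | ⟨X, rhs', d, j, -, -, hd, -, hj, hp⟩) |
      ⟨X, rhs', d, J, -, -, hd, -, hJ, hJlt, hdJ, hp⟩ <;>
    obtain ⟨rfl, rfl⟩ := Prod.mk.inj hp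
  · have hvars : varsOf [(Sum.inr (UVar.eq X e) : A ⊕ UVar V)] = [UVar.eq X e] := rfl
    rw [hvars] at hds
    obtain _ | ⟨h, _ | _⟩ := hds
    rw [dimOfList_singleton]
    exact le_of_eq_of_le h hed
  · rw [varsOf_relabel _ _ (by simp [hvars])] at hds
    cases hds
    rfl
  · rw [varsOf_relabel _ _ (by simp [hvars])] at hds
    obtain _ | ⟨h, _ | _⟩ := hds
    rw [dimOfList_singleton]
    exact h
  · rw [varsOf_relabel _ _ (by simp), List.forall₂_iff_get] at hds
    obtain ⟨hlen, hget⟩ := hds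
    rw [List.length_mapIdx] at hlen
    refine dimOfList_of_unique_max (hlen ▸ hj) ?_ fun i hi hij => ?_
    · simpa [UVar.Admits] using hget j (by simpa using hj) (hlen ▸ hj)
    · have := hget i (by simpa [hlen] using hi) hi
      simp only [List.get_eq_getElem, List.getElem_mapIdx, if_neg hij, UVar.Admits] at this
      omega
  · rw [varsOf_relabel _ _ (by simp), List.forall₂_iff_get] at hds
    obtain ⟨hlen, hget⟩ := hds
    rw [List.length_mapIdx] at hlen
    have heq : ∀ i (hi : i ∈ J), ds[i]'(hlen ▸ hJlt i hi) = d - 1 := fun i hi => by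
      simpa [UVar.Admits, hi] using hget i (by simpa using hJlt i hi) (hlen ▸ hJlt i hi)
    obtain ⟨a, ha, b, hb, hab⟩ := Finset.one_lt_card.mp hJ
    have hdim := dimOfList_of_repeated_max hab _ _ (heq a ha) (heq b hb) fun x hx => by
      obtain ⟨i, hi, rfl⟩ := List.getElem_of_mem hx
      by_cases hiJ : i ∈ J
      · exact (heq i hiJ).le
      · have := hget i (by simpa [hlen] using hi) hi
        simp only [List.get_eq_getElem, List.getElem_mapIdx, if_neg hiJ, UVar.Admits] at this
        omega
    exact hdim.trans (Nat.sub_add_cancel hd)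

theorem RawTree.IsDTree.admits_dim {V A : Type} {G : CFG V A} {k : ℕ} {Z : UVar V} :
    ∀ {t : RawTree (UVar V) A}, IsDTree (unfold G k) Z t → Z.Admits (dim t)
  | .node _ _ cs, .node hP hch => by
    rw [dim_node]
    refine admits_dimOfList_of_mem_unfoldP hP (List.forall₂_map_right_iff.mpr ?_)
    obtain ⟨hlen, hget⟩ := List.forall₂_iff_get.mp hch
    refine List.forall₂_iff_get.mpr ⟨hlen, fun i h₁ h₂ => ?_⟩
    have := List.sizeOf_lt_of_mem (List.get_mem cs ⟨i, h₂⟩)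
    exact (hget i h₁ h₂).admits_dim
termination_by t => sizeOf t
decreasing_by simp_wf; simp at this; omega


/-- Every `(G^{≤k}, X^{=d})`-derivation tree has dimension exactly `d`, and every
`(G^{≤k}, X^{≤d})`-derivation tree has dimension at most `d`. -/
theorem unfold_dim {V A : Type} [Fintype V] [Fintype A]
    (G : CFG V A) (hGfin : G.P.Finite) (k : ℕ) (X : V) (d : ℕ) (hd : d ≤ k) :
    (∀ t : RawTree (UVar V) A, IsDTree (unfold G k) (UVar.eq X d) t → dim t = d) ∧
    (∀ t : RawTree (UVar V) A, IsDTree (unfold G k) (UVar.le X d) t → dim t ≤ d) := by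
  exact ⟨fun _ h => h.admits_dim, fun _ h => h.admits_dim⟩
end

section
/- For every context-free grammar G = (V, Σ, P) and every k ∈ ℕ, the unfolded grammar G^{≤k} is nonexpansive: no variable Z of G^{≤k} admits a derivation Z ⇒⁺ α in G^{≤k} in which the sentential form α contains at least two occurrences of Z. -/
open RawTree

/-- A rank on annotated variables along which every production of `unfold G k` is weakly
decreasing, with at most one variable occurrence on the right-hand side of unchanged rank. -/
def UVar.rank {V : Type} : UVar V → ℕ
  | .le _ d => 2 * d + 1
  | .eq _ d => 2 * d

/-- All variables of `l` have rank at most `r`, and at most one occurrence has rank `r`. -/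
def RankBounded {V : Type} (r : ℕ) (l : List (UVar V)) : Prop :=
  (∀ z ∈ l, z.rank ≤ r) ∧ l.countP (fun z => decide (z.rank = r)) ≤ 1

theorem RankBounded.sublist {V : Type} {r : ℕ} {l₁ l₂ : List (UVar V)}
    (h : RankBounded r l₂) (hl : l₁.Sublist l₂) : RankBounded r l₁ :=
  ⟨fun z hz => h.1 z (hl.subset hz), hl.countP_le.trans h.2⟩

theorem rankBounded_of_forall_lt {V : Type} {r : ℕ} {l : List (UVar V)}
    (h : ∀ z ∈ l, z.rank < r) : RankBounded r l := by
  refine ⟨fun z hz => (h z hz).le, ?_⟩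
  rw [List.countP_eq_zero.2 (fun z hz => by simpa using (h z hz).ne)]
  exact zero_le_one

theorem rankBounded_singleton {V : Type} {r : ℕ} {z : UVar V} (h : z.rank ≤ r) :
    RankBounded r [z] :=
  ⟨by simpa using h, List.countP_le_length⟩

/-- Replacing one occurrence in a rank-bounded list by a list bounded by the rank of that
occurrence keeps the list rank-bounded. -/
theorem RankBounded.replace {V : Type} {r : ℕ} {l₁ l₂ l : List (UVar V)} {x : UVar V}
    (h : RankBounded r (l₁ ++ x :: l₂)) (hl : RankBounded x.rank l) :
    RankBounded r (l₁ ++ l ++ l₂) := by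
  obtain ⟨hle, hcount⟩ := h
  have hx : x.rank ≤ r := hle x (by simp)
  refine ⟨fun z hz => ?_, ?_⟩
  · simp only [List.mem_append] at hz
    rcases hz with (hz | hz) | hz
    · exact hle z (by simp [hz])
    · exact (hl.1 z hz).trans hx
    · exact hle z (by simp [hz])
  · simp only [List.countP_append, List.countP_cons] at hcount ⊢
    rcases hx.eq_or_lt with rfl | hlt
    · have := hl.2
      simp only [decide_true, if_true] at hcount
      omega
    · have hzero : l.countP (fun z => decide (z.rank = r)) = 0 :=
        List.countP_eq_zero.2 (fun z hz => by
          have := hl.1 z hz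
          simp only [decide_eq_true_eq]
          omega)
      omega

theorem varsOf_append {V A : Type} (l₁ l₂ : List (A ⊕ V)) :
    varsOf (l₁ ++ l₂) = varsOf l₁ ++ varsOf l₂ :=
  List.filterMap_append

theorem varsOf_inr_cons {V A : Type} (x : V) (l : List (A ⊕ V)) :
    varsOf (Sum.inr x :: l) = x :: varsOf l := rfl

theorem varsOf_inl_cons {V A : Type} (a : A) (l : List (A ⊕ V)) :
    varsOf (Sum.inl a :: l) = varsOf l := rfl

theorem count_varsOf {V A : Type} [DecidableEq V] [DecidableEq A] (z : V) (l : List (A ⊕ V)) :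
    (varsOf l).count z = l.count (Sum.inr z) := by
  induction l with
  | nil => rfl
  | cons s l ih =>
    cases s with
    | inl a =>
      have : ((Sum.inl a : A ⊕ V) == Sum.inr z) = false := rfl
      simp [varsOf_inl_cons, List.count_cons, ih, this]
    | inr x =>
      have : ((Sum.inr x : A ⊕ V) == Sum.inr z) = (x == z) := rfl
      simp only [varsOf_inr_cons, List.count_cons, ih, this]

theorem varsOf_relabel_sublist {V A : Type} (rhs : List (A ⊕ V)) (zs : List (UVar V)) :
    (varsOf (relabel rhs zs)).Sublist zs := by
  induction rhs generalizing zs with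
  | nil => exact List.nil_sublist _
  | cons s rest ih =>
    rcases s with a | x
    · exact ih zs
    · cases zs with
      | nil => exact ih []
      | cons z zs => exact (ih zs).cons_cons z

theorem countP_mapIdx_le_one {α β : Type} (p : β → Bool) (l : List α) (f : ℕ → α → β) (j : ℕ)
    (h : ∀ i a, i ≠ j → p (f i a) = false) : (l.mapIdx f).countP p ≤ 1 := by
  induction l generalizing f j with
  | nil => simp
  | cons a l ih =>
    rw [List.mapIdx_cons, List.countP_cons]
    cases j with
    | zero =>
      have hzero : (l.mapIdx fun i => f (i + 1)).countP p = 0 := by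
        refine List.countP_eq_zero.2 fun b hb => ?_
        obtain ⟨i, hi, rfl⟩ := List.mem_mapIdx.1 hb
        simp [h (i + 1) _ (Nat.succ_ne_zero i)]
      rw [hzero]
      split <;> simp
    | succ j =>
      have := ih (fun i => f (i + 1)) j (fun i a hi => h (i + 1) a (by omega))
      simpa [h 0 a (Nat.succ_ne_zero j).symm] using this

theorem rankBounded_varsOf_of_mem_unfoldP {V A : Type} {G : CFG V A} {k : ℕ} {Z : UVar V}
    {rhs : List (A ⊕ UVar V)} (h : (Z, rhs) ∈ unfoldP G k) :
    RankBounded Z.rank (varsOf rhs) := by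
  rcases h with (((⟨X, d, e, he, -, h⟩ | ⟨X, u, -, -, h⟩) | ⟨X, u, Y, d, -, -, -, h⟩) |
    ⟨X, u, d, j, -, -, hd, -, -, h⟩) | ⟨X, u, d, J, -, -, hd, -, -, -, -, h⟩ <;>
    obtain ⟨rfl, rfl⟩ := Prod.mk.inj h
  · exact rankBounded_singleton (by simp only [UVar.rank]; omega)
  · exact (rankBounded_of_forall_lt (by simp)).sublist (varsOf_relabel_sublist _ _)
  · exact (rankBounded_singleton (z := UVar.eq Y d) le_rfl).sublist (varsOf_relabel_sublist _ _)
  · refine RankBounded.sublist ⟨fun z hz => ?_, countP_mapIdx_le_one _ _ _ j fun i a hi => ?_⟩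
      (varsOf_relabel_sublist _ _)
    · obtain ⟨i, hi, rfl⟩ := List.mem_mapIdx.1 hz
      split <;> simp only [UVar.rank] <;> omega
    · simp only [if_neg hi, UVar.rank, decide_eq_false_iff_not]
      omega
  · refine (rankBounded_of_forall_lt fun z hz => ?_).sublist (varsOf_relabel_sublist _ _)
    obtain ⟨i, hi, rfl⟩ := List.mem_mapIdx.1 hz
    split <;> simp only [UVar.rank] <;> omega

theorem RankBounded.produces {V A : Type} {G : CFG V A} {k r : ℕ} {α β : List (A ⊕ UVar V)}
    (hα : RankBounded r (varsOf α)) (h : Produces (unfold G k) α β) :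
    RankBounded r (varsOf β) := by
  obtain ⟨pre, post, X, rhs, hP, rfl, rfl⟩ := h
  rw [varsOf_append, varsOf_inr_cons] at hα
  rw [varsOf_append, varsOf_append]
  exact hα.replace (rankBounded_varsOf_of_mem_unfoldP hP)

/-- The unfolded grammar `G^{≤k}` is nonexpansive: no variable `Z` of `G^{≤k}` admits
a derivation `Z ⇒⁺ α` in which `α` contains at least two occurrences of `Z`. -/
theorem unfold_nonexpansive {V A : Type} [Fintype V] [Fintype A]
    [DecidableEq V] [DecidableEq A] (G : CFG V A) (hGfin : G.P.Finite) (k : ℕ) :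
    ∀ (Z : UVar V) (α : List (A ⊕ UVar V)),
      DerivesPlus (unfold G k) [Sum.inr Z] α → ¬ (2 ≤ α.count (Sum.inr Z)) := by
  intro Z α h
  have hα : RankBounded Z.rank (varsOf α) := by
    induction h with
    | single h => exact RankBounded.produces (rankBounded_singleton le_rfl) h
    | tail _ h ih => exact ih.produces h
  have hle : (varsOf α).count Z ≤ (varsOf α).countP (fun z => decide (z.rank = Z.rank)) :=
    List.countP_mono_left fun z _ hz => by simp [beq_iff_eq.1 hz]
  have := hα.2
  rw [count_varsOf] at hle
  omega
end

section
/- Let G = (V, Σ, P) be a nonexpansive context-free grammar. Then every (G,X)-derivation tree t satisfies dim(t) < l(t); in particular, every (G,X)-derivation tree has dimension less than |V|. -/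
open RawTree

instance Sum.lawfulBEq {α β : Type*} [BEq α] [BEq β] [LawfulBEq α] [LawfulBEq β] :
    LawfulBEq (α ⊕ β) where
  eq_of_beq {a b} h := by
    rcases a with a | a <;> rcases b with b | b
    · exact congrArg _ (eq_of_beq (α := α) h)
    · exact absurd h Bool.false_ne_true
    · exact absurd h Bool.false_ne_true
    · exact congrArg _ (eq_of_beq (α := β) h)
  rfl {a} := by
    rcases a with a | a
    · exact BEq.refl (α := α) a
    · exact BEq.refl (α := β) a

namespace RawTree

variable {V A : Type}

theorem induction_on_children {motive : RawTree V A → Prop}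
    (node : ∀ X rhs cs, (∀ c ∈ cs, motive c) → motive (.node X rhs cs)) :
    ∀ t, motive t
  | .node X rhs cs => node X rhs cs fun c _ => induction_on_children node c
decreasing_by have := List.sizeOf_lt_of_mem ‹c ∈ cs›; simp; omega

theorem mem_lhsVars_node [DecidableEq V] {X Y : V} {rhs : List (A ⊕ V)}
    {cs : List (RawTree V A)} :
    Y ∈ lhsVars (.node X rhs cs) ↔ Y = X ∨ ∃ c ∈ cs, Y ∈ lhsVars c := by
  have mem_foldr (l : List (Finset V)) :
      Y ∈ l.foldr (· ∪ ·) ∅ ↔ ∃ s ∈ l, Y ∈ s := by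
    induction l <;> simp_all
  rw [lhsVars, Finset.mem_insert, mem_foldr]
  simp

theorem lhsVars_subset_node [DecidableEq V] {X : V} {rhs : List (A ⊕ V)}
    {cs : List (RawTree V A)} {c : RawTree V A} (hc : c ∈ cs) :
    lhsVars c ⊆ lhsVars (.node X rhs cs) :=
  fun _ hY => mem_lhsVars_node.2 (.inr ⟨c, hc, hY⟩)

/-- The dimension of a node is zero, or the dimension of one of its children, or one more than
the common dimension of two distinct child positions. -/
theorem dim_node_cases (X : V) (rhs : List (A ⊕ V)) (cs : List (RawTree V A)) :
    dim (.node X rhs cs) = 0 ∨ (∃ c ∈ cs, dim (.node X rhs cs) = dim c) ∨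
      ∃ c₁ c₂, [c₁, c₂].Sublist cs ∧ dim (.node X rhs cs) = dim c₁ + 1 ∧
        dim c₂ = dim c₁ := by
  have foldr_max_mem (l : List ℕ) (hl : l ≠ []) : l.foldr max 0 ∈ l := by
    induction l with
    | nil => exact absurd rfl hl
    | cons a l ih =>
      rcases eq_or_ne l [] with rfl | hl'
      · simp
      · rcases max_choice a (l.foldr max 0) with h | h <;> simp_all
  rw [dim]
  simp only [List.map_attach_eq_pmap, List.pmap_eq_map]
  split_ifs with h0 h1
  · exact .inl rfl
  · have hm := foldr_max_mem (cs.map dim) (by simpa using h0)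
    obtain ⟨c, hc, hd⟩ := List.mem_map.1 hm
    exact .inr (.inl ⟨c, hc, hd.symm⟩)
  · have hm := foldr_max_mem (cs.map dim) (by simpa using h0)
    generalize (cs.map dim).foldr max 0 = d at *
    have hcount : 2 ≤ (cs.map dim).count d := by
      have := List.count_pos_iff.2 hm
      omega
    obtain ⟨l, hl, hmap⟩ := List.sublist_map_iff.1 (List.replicate_sublist_iff.2 hcount)
    obtain ⟨c₁, c₂, rfl⟩ :=
      List.length_eq_two.1 (by simpa using (congrArg List.length hmap).symm)
    simp only [List.replicate_succ, List.replicate_zero, List.map_cons, List.map_nil,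
      List.cons.injEq, and_true] at hmap
    exact .inr (.inr ⟨c₁, c₂, hl, by omega, by omega⟩)

end RawTree

section Derivations

variable {V A : Type} {G : CFG V A}

theorem Produces.of_mem {X : V} {rhs : List (A ⊕ V)} (h : (X, rhs) ∈ G.P) :
    Produces G [Sum.inr X] rhs :=
  ⟨[], [], X, rhs, h, by simp, by simp⟩

theorem Derives.append_both {α β : List (A ⊕ V)} (h : Derives G α β) (p q : List (A ⊕ V)) :
    Derives G (p ++ α ++ q) (p ++ β ++ q) := by
  refine Relation.ReflTransGen.lift (fun γ => p ++ γ ++ q) ?_ _ _ h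
  rintro _ _ ⟨pre, post, X, rhs, hP, rfl, rfl⟩
  exact ⟨p ++ pre, post ++ q, X, rhs, hP, by simp, by simp⟩

theorem Derives.append {α α' β β' : List (A ⊕ V)} (h : Derives G α α') (h' : Derives G β β') :
    Derives G (α ++ β) (α' ++ β') := by
  have h₁ := h.append_both [] β
  have h₂ := h'.append_both α' []
  simp only [List.nil_append, List.append_nil] at h₁ h₂
  exact Relation.ReflTransGen.trans h₁ h₂

theorem Derives.exists_mem {α : List (A ⊕ V)} {X Y : V} (hX : Sum.inr X ∈ α)
    (h : ∃ β, Derives G [Sum.inr X] β ∧ Sum.inr Y ∈ β) :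
    ∃ β, Derives G α β ∧ Sum.inr Y ∈ β := by
  obtain ⟨β, hβ, hY⟩ := h
  obtain ⟨p, q, rfl⟩ := List.append_of_mem hX
  exact ⟨p ++ β ++ q, by simpa using hβ.append_both p q, by simp [hY]⟩

theorem inr_mem_of_mem_varsOf {rhs : List (A ⊕ V)} {X : V} (h : X ∈ varsOf rhs) :
    Sum.inr X ∈ rhs := by
  simpa [varsOf] using h

theorem List.Forall₂.exists_sublist_of_sublist_right {α β : Type*} {R : α → β → Prop}
    {l : List α} {m m' : List β} (h : List.Forall₂ R l m) (hm : m'.Sublist m) :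
    ∃ l', l'.Sublist l ∧ List.Forall₂ R l' m' := by
  induction hm generalizing l with
  | slnil => exact ⟨[], by simp, .nil⟩
  | cons b _ ih =>
    cases h with
    | cons _ h =>
      obtain ⟨l', hl, hR⟩ := ih h
      exact ⟨l', hl.cons _, hR⟩
  | cons_cons b _ ih =>
    cases h with
    | cons hab h =>
      obtain ⟨l', hl, hR⟩ := ih h
      exact ⟨_, hl.cons_cons _, .cons hab hR⟩

/-- Every variable labelling a node of a derivation tree is reachable from its root. -/
theorem IsDTree.exists_derives_of_mem_lhsVars [DecidableEq V] {Y : V} (t : RawTree V A) :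
    ∀ X, IsDTree G X t → Y ∈ lhsVars t → ∃ β, Derives G [Sum.inr X] β ∧ Sum.inr Y ∈ β := by
  induction t using RawTree.induction_on_children with
  | node Z rhs cs ih =>
    rintro X ⟨hP, hch⟩ hY
    rcases mem_lhsVars_node.1 hY with rfl | ⟨c, hc, hY⟩
    · exact ⟨_, .refl, by simp⟩
    · obtain ⟨l, hl, hR⟩ :=
        hch.exists_sublist_of_sublist_right (List.singleton_sublist.2 hc)
      obtain ⟨W, _, hW, hnil, rfl⟩ := List.forall₂_cons_right_iff.1 hR
      have hmem : W ∈ varsOf rhs := hl.subset (by simp)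
      obtain ⟨β, hβ, hYβ⟩ :=
        Derives.exists_mem (inr_mem_of_mem_varsOf hmem) (ih c hc W hW hY)
      exact ⟨β, .head (.of_mem hP) hβ, hYβ⟩

/-- In a nonexpansive grammar, the root variable of a derivation tree cannot reoccur below two
distinct child positions. -/
theorem Nonexpansive.not_mem_lhsVars_of_sublist [DecidableEq V] [DecidableEq A]
    (hne : Nonexpansive G) {X : V} {rhs : List (A ⊕ V)} {cs : List (RawTree V A)}
    (hP : (X, rhs) ∈ G.P) (hch : List.Forall₂ (IsDTree G) (varsOf rhs) cs)
    {c₁ c₂ : RawTree V A} (hsub : [c₁, c₂].Sublist cs)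
    (h₁ : X ∈ lhsVars c₁) (h₂ : X ∈ lhsVars c₂) : False := by
  obtain ⟨l, hl, hR⟩ := hch.exists_sublist_of_sublist_right hsub
  obtain ⟨W₁, _, hW₁, hR', rfl⟩ := List.forall₂_cons_right_iff.1 hR
  obtain ⟨W₂, _, hW₂, hnil, rfl⟩ := List.forall₂_cons_right_iff.1 hR'
  cases hnil
  obtain ⟨s₁, s₂, rfl, hm₁, hm₂⟩ :
      ∃ s₁ s₂, rhs = s₁ ++ s₂ ∧ Sum.inr W₁ ∈ s₁ ∧ Sum.inr W₂ ∈ s₂ := by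
    obtain ⟨s₁, s₂, hs, hm₁, hm₂⟩ := List.cons_sublist_iff.1 hl
    obtain ⟨u₁, u₂, rfl, rfl, rfl⟩ := List.filterMap_eq_append_iff.1 hs
    exact ⟨u₁, u₂, rfl, inr_mem_of_mem_varsOf hm₁,
      inr_mem_of_mem_varsOf (List.singleton_sublist.1 hm₂)⟩
  obtain ⟨β₁, hβ₁, hX₁⟩ :=
    Derives.exists_mem hm₁ (IsDTree.exists_derives_of_mem_lhsVars c₁ W₁ hW₁ h₁)
  obtain ⟨β₂, hβ₂, hX₂⟩ :=
    Derives.exists_mem hm₂ (IsDTree.exists_derives_of_mem_lhsVars c₂ W₂ hW₂ h₂)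
  have hle := hne X (β₁ ++ β₂) (Relation.TransGen.head' (.of_mem hP) (hβ₁.append hβ₂))
  have hp₁ := List.count_pos_iff.2 hX₁
  have hp₂ := List.count_pos_iff.2 hX₂
  rw [List.count_append] at hle
  omega

theorem Nonexpansive.dim_lt_numLhsVars [DecidableEq V] [DecidableEq A]
    (hne : Nonexpansive G) (t : RawTree V A) :
    ∀ X, IsDTree G X t → dim t < numLhsVars t := by
  induction t using RawTree.induction_on_children with
  | node Z rhs cs ih =>
    rintro _ ⟨hP, hch⟩
    have lt_of_mem {c : RawTree V A} (hc : c ∈ cs) : dim c < (lhsVars c).card := by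
      obtain ⟨l, hl, hR⟩ :=
        hch.exists_sublist_of_sublist_right (List.singleton_sublist.2 hc)
      obtain ⟨W, _, hW, -, -⟩ := List.forall₂_cons_right_iff.1 hR
      exact ih c hc W hW
    have hX : Z ∈ lhsVars (.node Z rhs cs) := mem_lhsVars_node.2 (.inl rfl)
    rw [numLhsVars]
    rcases dim_node_cases Z rhs cs with h | ⟨c, hc, h⟩ | ⟨c₁, c₂, hsub, h, heq⟩
    · rw [h]
      exact Finset.card_pos.2 ⟨Z, hX⟩
    · rw [h]
      exact (lt_of_mem hc).trans_le (Finset.card_le_card (lhsVars_subset_node hc))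
    · have hc₁ : c₁ ∈ cs := hsub.subset (by simp)
      have hc₂ : c₂ ∈ cs := hsub.subset (by simp)
      have hlt₁ := lt_of_mem hc₁
      have hlt₂ := lt_of_mem hc₂
      by_contra! hle
      have mem_of_card_le {c : RawTree V A} (hc : c ∈ cs)
          (hcard : (lhsVars (.node Z rhs cs)).card ≤ (lhsVars c).card) : Z ∈ lhsVars c := by
        rwa [Finset.eq_of_subset_of_card_le (lhsVars_subset_node hc) hcard]
      exact hne.not_mem_lhsVars_of_sublist hP hch hsub
        (mem_of_card_le hc₁ (by omega)) (mem_of_card_le hc₂ (by omega))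

end Derivations

/-- In a nonexpansive grammar, every `(G,X)`-derivation tree `t` satisfies
`dim(t) < l(t)`; in particular its dimension is less than `|V|`. -/
theorem nonexpansive_dim_lt {V A : Type} [Fintype V] [Fintype A]
    [DecidableEq V] [DecidableEq A] (G : CFG V A) (hGfin : G.P.Finite)
    (hne : Nonexpansive G) (X : V) (t : RawTree V A) (ht : IsDTree G X t) :
    dim t < numLhsVars t ∧ dim t < Fintype.card V := by
  have h := hne.dim_lt_numLhsVars t X ht
  exact ⟨h, h.trans_le (Finset.card_le_univ _)⟩
end
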